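/- arXiv:1010.5552 — 2 statements merged into one kernel-verified Lean document; each statement's English description precedes it below -/
import Mathlib

section
/- Let d ≥ 1 and let G̃ = (I,P;E) be a pinned d-isostatic graph. Then G̃ is strongly d-Assur if and only if there is a dense open set of configurations p : I ∪ P → ℝ^d such that for every edge e ∈ E there exists a continuous path q : [0,1] → (ℝ^d)^{I ∪ P} with q(0) = p, with q(t)(w) = p(w) for every pinned vertex w ∈ P and all t, with ‖q(t)(u) − q(t)(v)‖ = ‖p(u) − p(v)‖ for every edge {u,v} ∈ E ∖ {e} and all t, and such that for every inner vertex i ∈ I the map t ↦ q(t)(i) is nonconstant (a finite motion that is nonzero at all inner vertices). -/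
open Matrix

/-- A pinned graph: the vertex set `V` is partitioned into inner and pinned vertices,
and each edge is an unordered pair of distinct vertices with at least one inner endpoint. -/
structure PinnedGraph (V : Type) [Fintype V] [DecidableEq V] where
  inner : Finset V
  pinned : Finset V
  disj : Disjoint inner pinned
  cover : inner ∪ pinned = Finset.univ
  edges : Finset (Sym2 V)
  loopless : ∀ e ∈ edges, ¬ e.IsDiag
  edge_inner : ∀ e ∈ edges, ∃ v, v ∈ e ∧ v ∈ inner

variable {V : Type} [Fintype V] [DecidableEq V]

/-- The pinned rigidity matrix in dimension `d`, with rows indexed by the edge set `E'`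
and a block of `d` columns for each vertex of the inner-vertex set `I'`:  in the row of
edge `{u,v}` the block of an endpoint `u ∈ I'` is `p u - p v`, and all other blocks
are zero. -/
noncomputable def rMatrix (d : ℕ) (p : V → EuclideanSpace ℝ (Fin d))
    (I' : Finset V) (E' : Finset (Sym2 V)) :
    Matrix {e // e ∈ E'} ({i // i ∈ I'} × Fin d) ℝ :=
  Matrix.of fun e ik =>
    if h : (ik.1 : V) ∈ (e : Sym2 V) then (p ik.1 - p (Sym2.Mem.other' h)) ik.2
    else 0

/-- A matrix has trivial kernel; for a square matrix this is invertibility. -/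
def KernelTrivial {m n : Type} [Fintype n] (M : Matrix m n ℝ) : Prop :=
  ∀ U : n → ℝ, M.mulVec U = 0 → U = 0

/-- The pinned graph with inner vertices `I'` and edges `E'` is pinned `d`-isostatic at the
configuration `p` : the edge count is `d|I'|` and the pinned rigidity matrix is invertible. -/
def IsostaticAt (d : ℕ) (p : V → EuclideanSpace ℝ (Fin d))
    (I' : Finset V) (E' : Finset (Sym2 V)) : Prop :=
  E'.card = d * I'.card ∧ KernelTrivial (rMatrix d p I' E')

/-- `(I',P';E')` is a subgraph of the pinned graph `G`. -/
structure IsSubgraph (G : PinnedGraph V) (I' P' : Finset V) (E' : Finset (Sym2 V)) : Prop where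
  inner_sub : I' ⊆ G.inner
  pinned_sub : P' ⊆ G.pinned
  edges_sub : E' ⊆ G.edges
  endpoints : ∀ e ∈ E', ∀ v ∈ e, v ∈ I' ∪ P'
  edge_inner : ∀ e ∈ E', ∃ v, v ∈ e ∧ v ∈ I'

/-- A `d`-Assur graph: a pinned `d`-isostatic graph with no proper pinned `d`-isostatic
subgraph having a nonempty inner-vertex set. -/
def IsAssur (d : ℕ) (G : PinnedGraph V) : Prop :=
  (∃ p, IsostaticAt d p G.inner G.edges) ∧
  ∀ I' P' E', IsSubgraph G I' P' E' → I'.Nonempty → E' ≠ G.edges →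
    ¬ ∃ p, IsostaticAt d p I' E'

/-- An orientation of the edges of a pinned graph: each edge is assigned an initial vertex. -/
structure GOrient (G : PinnedGraph V) where
  init : {e // e ∈ G.edges} → V
  init_mem : ∀ e, init e ∈ Subtype.val e

/-- The terminal vertex of an edge under an orientation. -/
noncomputable def GOrient.term {G : PinnedGraph V} (O : GOrient G)
    (e : {e // e ∈ G.edges}) : V :=
  Sym2.Mem.other' (O.init_mem e)

/-- The out-degree of a vertex under an orientation. -/
def GOrient.outDeg {G : PinnedGraph V} (O : GOrient G) (v : V) : ℕ :=
  (Finset.univ.filter fun e => O.init e = v).card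

/-- A `d`-directed orientation: every inner vertex has out-degree `d` and every pinned
vertex has out-degree `0`. -/
def IsDDirected (d : ℕ) {G : PinnedGraph V} (O : GOrient G) : Prop :=
  (∀ v ∈ G.inner, O.outDeg v = d) ∧ ∀ v ∈ G.pinned, O.outDeg v = 0

/-- A strongly `d`-Assur graph: a `d`-Assur graph such that on a dense open set of
configurations, deleting the row of any edge from the pinned rigidity matrix leaves a
matrix with a kernel vector that is nonzero at every inner vertex. -/
def IsStronglyAssur (d : ℕ) (G : PinnedGraph V) : Prop :=
  IsAssur d G ∧
  ∃ S : Set (V → EuclideanSpace ℝ (Fin d)), IsOpen S ∧ Dense S ∧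
    ∀ p ∈ S, ∀ e ∈ G.edges,
      ∃ U : {i // i ∈ G.inner} → EuclideanSpace ℝ (Fin d),
        (∀ i, U i ≠ 0) ∧
        (rMatrix d p G.inner (G.edges.erase e)).mulVec (fun ik => U ik.1 ik.2) = 0

set_option linter.unusedSectionVars false

noncomputable def xExt (d : ℕ) (I' : Finset V) (p : V → EuclideanSpace ℝ (Fin d))
    (x : {i // i ∈ I'} × Fin d → ℝ) : V → EuclideanSpace ℝ (Fin d) :=
  fun v => if h : v ∈ I' then WithLp.toLp 2 (fun k => x (⟨v, h⟩, k)) else p v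

noncomputable def sqlen {d : ℕ} (p : V → EuclideanSpace ℝ (Fin d)) (e : Sym2 V) : ℝ :=
  Sym2.lift ⟨fun u v => ‖p u - p v‖ ^ 2 / 2, fun u v => by simp only [norm_sub_rev]⟩ e

lemma sqlen_mk {d : ℕ} (p : V → EuclideanSpace ℝ (Fin d)) (u v : V) :
    sqlen p s(u, v) = ‖p u - p v‖ ^ 2 / 2 := rfl

lemma other_left {u v : V} (h : u ∈ s(u, v)) : Sym2.Mem.other' h = v := by
  exact Sym2.congr_right.1 (Sym2.other_spec' h)

lemma other_right {u v : V} (h : v ∈ s(u, v)) : Sym2.Mem.other' h = u := by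
  exact Sym2.congr_right.1 ((Sym2.other_spec' h).trans Sym2.eq_swap)

lemma row_formula {d : ℕ} (p : V → EuclideanSpace ℝ (Fin d)) (I' : Finset V)
    (E' : Finset (Sym2 V)) (U : {i // i ∈ I'} × Fin d → ℝ) (u v : V) (huv : u ≠ v)
    (h : s(u, v) ∈ E') :
    (rMatrix d p I' E').mulVec U ⟨s(u, v), h⟩
      = inner ℝ (p u - p v) (xExt d I' 0 U u - xExt d I' 0 U v) := by
  have key : ∀ w : V, (if hw : w ∈ I' then ∑ k, rMatrix d p I' E' ⟨s(u, v), h⟩ (⟨w, hw⟩, k) *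
      U (⟨w, hw⟩, k) else 0)
      = (if w = u then inner ℝ (p u - p v) (xExt d I' 0 U u) else 0)
        + (if w = v then inner ℝ (p v - p u) (xExt d I' 0 U v) else 0) := by
    intro w
    by_cases h1 : w = u
    · subst h1
      by_cases hw : w ∈ I'
      · simp [hw, huv, xExt, rMatrix, other_left, PiLp.inner_apply, mul_comm]
      · simp [hw, huv, xExt]
    · by_cases h2 : w = v
      · subst h2
        by_cases hw : w ∈ I'
        · simp [hw, h1, xExt, rMatrix, other_right, PiLp.inner_apply, mul_comm]
        · simp [hw, h1, xExt]
      · have : w ∉ s(u, v) := by simp [h1, h2]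
        simp [rMatrix, h1, h2]
  have h2 : (rMatrix d p I' E').mulVec U ⟨s(u, v), h⟩ = ∑ w : V, (if hw : w ∈ I' then
      ∑ k, rMatrix d p I' E' ⟨s(u, v), h⟩ (⟨w, hw⟩, k) * U (⟨w, hw⟩, k) else 0) := by
    rw [Matrix.mulVec, dotProduct, Fintype.sum_prod_type]
    rw [Finset.sum_dite]
    simp only [Finset.sum_const_zero, add_zero]
    refine Finset.sum_bij' (fun a _ => ⟨a.1, by simp⟩) (fun a _ => ⟨a.1, by simpa using a.2⟩) ?_ ?_ ?_ ?_ ?_ <;> simp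
  rw [h2, Finset.sum_congr rfl (fun w _ => key w), Finset.sum_add_distrib]
  simp only [Finset.sum_ite_eq', Finset.mem_univ, if_true]
  rw [inner_sub_right, ← neg_sub (p u) (p v), inner_neg_left]
  ring

lemma dense_ne {X : Type*} [NormedAddCommGroup X] [NormedSpace ℝ X] (D : X → ℝ)
    (hD : ∀ x, AnalyticAt ℝ D x) (h : ∃ x, D x ≠ 0) :
    IsOpen {x | D x ≠ 0} ∧ Dense {x | D x ≠ 0} := by
  have hc : Continuous D := continuous_iff_continuousAt.2 fun x => (hD x).continuousAt
  refine ⟨isOpen_ne_fun hc continuous_const, ?_⟩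
  obtain ⟨x0, hx0⟩ := h
  rw [dense_iff_closure_eq, Set.eq_univ_iff_forall]
  intro x
  by_contra hx
  apply hx0
  have hev : D =ᶠ[nhds x] 0 := by
    rw [mem_closure_iff_frequently] at hx
    rw [Filter.not_frequently] at hx
    exact hx.mono fun y hy => not_not.1 hy
  exact AnalyticOnNhd.eqOn_zero_of_preconnected_of_eventuallyEq_zero (U := Set.univ)
    (fun y _ => hD y) isPreconnected_univ (Set.mem_univ x) hev (Set.mem_univ x0)

lemma det_analytic {X J : Type*} [NormedAddCommGroup X] [NormedSpace ℝ X] [Fintype J]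
    [DecidableEq J] (M : X → Matrix J J ℝ) (x : X) (h : ∀ a b, AnalyticAt ℝ (fun x => M x a b) x) :
    AnalyticAt ℝ (fun x => (M x).det) x := by
  simp only [Matrix.det_apply']
  refine Finset.analyticAt_fun_sum _ fun σ _ => ?_
  exact analyticAt_const.mul (Finset.analyticAt_fun_prod _ fun i _ => h _ _)

lemma entry_analytic {d : ℕ} (I' : Finset V) (E' : Finset (Sym2 V))
    (a : {e // e ∈ E'}) (b : {i // i ∈ I'} × Fin d) (p : V → EuclideanSpace ℝ (Fin d)) :
    AnalyticAt ℝ (fun p => rMatrix d p I' E' a b) p := by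
  simp only [rMatrix, Matrix.of_apply]
  split_ifs with h
  · exact ((EuclideanSpace.proj b.2 : _ →L[ℝ] ℝ).comp
      ((ContinuousLinearMap.proj (R := ℝ) (φ := fun _ : V => EuclideanSpace ℝ (Fin d)) (b.1 : V))
       - (ContinuousLinearMap.proj (R := ℝ) (φ := fun _ : V => EuclideanSpace ℝ (Fin d)) (Sym2.Mem.other' h)))).analyticAt p
  · exact analyticAt_const

noncomputable def sqM (d : ℕ) (I' : Finset V) (E' : Finset (Sym2 V))
    (σ : {e // e ∈ E'} ≃ {i // i ∈ I'} × Fin d) (p : V → EuclideanSpace ℝ (Fin d)) :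
    Matrix ({i // i ∈ I'} × Fin d) ({i // i ∈ I'} × Fin d) ℝ :=
  (rMatrix d p I' E').submatrix σ.symm id

lemma sqM_mulVec {d : ℕ} {I' : Finset V} {E' : Finset (Sym2 V)}
    (σ : {e // e ∈ E'} ≃ {i // i ∈ I'} × Fin d) (p : V → EuclideanSpace ℝ (Fin d)) (U)
    (e : {e // e ∈ E'}) :
    (sqM d I' E' σ p).mulVec U (σ e) = (rMatrix d p I' E').mulVec U e := by
  simp [sqM, Matrix.mulVec, dotProduct]

lemma exists_sigma {d : ℕ} {I' : Finset V} {E' : Finset (Sym2 V)} (h : E'.card = d * I'.card) :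
    Nonempty ({e // e ∈ E'} ≃ {i // i ∈ I'} × Fin d) := by
  refine ⟨Fintype.equivOfCardEq ?_⟩
  simp [h, mul_comm]

lemma kt_iff {d : ℕ} {I' : Finset V} {E' : Finset (Sym2 V)}
    (σ : {e // e ∈ E'} ≃ {i // i ∈ I'} × Fin d) (p : V → EuclideanSpace ℝ (Fin d)) :
    KernelTrivial (rMatrix d p I' E') ↔ (sqM d I' E' σ p).det ≠ 0 := by
  rw [Ne, ← Matrix.exists_mulVec_eq_zero_iff]
  have : ∀ U, (sqM d I' E' σ p).mulVec U = 0 ↔ (rMatrix d p I' E').mulVec U = 0 := by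
    intro U
    constructor
    · intro h; ext e; rw [← sqM_mulVec σ, h]; rfl
    · intro h; ext j; obtain ⟨e, rfl⟩ := σ.surjective j; rw [sqM_mulVec σ, h]; rfl
  simp only [this, KernelTrivial]
  push Not
  constructor
  · intro h U hU h2; exact hU (h U h2)
  · intro h U hU; by_contra h2; exact h U h2 hU

lemma sqM_entry_analytic {d : ℕ} {I' : Finset V} {E' : Finset (Sym2 V)}
    (σ : {e // e ∈ E'} ≃ {i // i ∈ I'} × Fin d) (a b) (p : V → EuclideanSpace ℝ (Fin d)) :
    AnalyticAt ℝ (fun p => sqM d I' E' σ p a b) p := entry_analytic _ _ _ _ _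

lemma adj_analytic {d : ℕ} {I' : Finset V} {E' : Finset (Sym2 V)}
    (σ : {e // e ∈ E'} ≃ {i // i ∈ I'} × Fin d) (a b) (p : V → EuclideanSpace ℝ (Fin d)) :
    AnalyticAt ℝ (fun p => (sqM d I' E' σ p).adjugate a b) p := by
  simp only [Matrix.adjugate_apply]
  refine det_analytic _ _ fun i j => ?_
  simp only [Matrix.updateRow_apply]
  split_ifs
  · exact analyticAt_const
  · exact sqM_entry_analytic σ _ _ _

lemma dense_kt {d : ℕ} {I' : Finset V} {E' : Finset (Sym2 V)}
    (h : ∃ p : V → EuclideanSpace ℝ (Fin d), IsostaticAt d p I' E') :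
    IsOpen {p : V → EuclideanSpace ℝ (Fin d) | KernelTrivial (rMatrix d p I' E')} ∧
    Dense {p : V → EuclideanSpace ℝ (Fin d) | KernelTrivial (rMatrix d p I' E')} := by
  obtain ⟨p, hc, hp⟩ := h
  obtain ⟨σ⟩ := exists_sigma hc
  simp only [kt_iff σ] at hp ⊢
  exact dense_ne _ (fun p => det_analytic _ _ fun a b => sqM_entry_analytic σ a b p) ⟨p, hp⟩

noncomputable def xLin (d : ℕ) (I' : Finset V) (v : V) :
    ({i // i ∈ I'} × Fin d → ℝ) →L[ℝ] EuclideanSpace ℝ (Fin d) :=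
  LinearMap.toContinuousLinearMap
    { toFun := fun x => xExt d I' 0 x v
      map_add' := by intro x y; ext k; simp only [xExt]; split_ifs <;> simp
      map_smul' := by intro c y; ext k; simp only [xExt]; split_ifs <;> simp }

lemma xExt_eq {d : ℕ} (I' : Finset V) (p : V → EuclideanSpace ℝ (Fin d)) (x) (v : V) :
    xExt d I' p x v = xExt d I' p 0 v + xLin d I' v x := by
  ext k
  simp only [xLin, LinearMap.coe_toContinuousLinearMap', LinearMap.coe_mk, AddHom.coe_mk, xExt]
  split_ifs <;> simp

lemma xExt_strict {d : ℕ} (I' : Finset V) (p : V → EuclideanSpace ℝ (Fin d)) (x) (v : V) :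
    HasStrictFDerivAt (fun x => xExt d I' p x v) (xLin d I' v) x := by
  rw [show (fun x => xExt d I' p x v) = fun x => xExt d I' p 0 v + xLin d I' v x from
    funext fun x => xExt_eq I' p x v]
  exact (xLin d I' v).hasStrictFDerivAt.const_add _

lemma xExt_cont {d : ℕ} (I' : Finset V) (p : V → EuclideanSpace ℝ (Fin d)) :
    Continuous (fun x => xExt d I' p x) :=
  continuous_pi fun v => continuous_iff_continuousAt.2 fun x =>
    (xExt_strict I' p x v).continuousAt

noncomputable def Fmap (d : ℕ) (I' : Finset V) (E' : Finset (Sym2 V))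
    (σ : {e // e ∈ E'} ≃ {i // i ∈ I'} × Fin d) (p : V → EuclideanSpace ℝ (Fin d))
    (x : {i // i ∈ I'} × Fin d → ℝ) : {i // i ∈ I'} × Fin d → ℝ :=
  fun j => sqlen (xExt d I' p x) (σ.symm j)

noncomputable def mL {J : Type*} [Fintype J] [DecidableEq J] (M : Matrix J J ℝ) :
    (J → ℝ) →L[ℝ] (J → ℝ) := LinearMap.toContinuousLinearMap (Matrix.toLin' M)

lemma mL_apply {J : Type*} [Fintype J] [DecidableEq J] (M : Matrix J J ℝ) (x) :
    mL M x = M.mulVec x := rfl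

lemma Fmap_strict {d : ℕ} {I' : Finset V} {E' : Finset (Sym2 V)}
    (hl : ∀ e ∈ E', ¬ e.IsDiag)
    (σ : {e // e ∈ E'} ≃ {i // i ∈ I'} × Fin d) (p : V → EuclideanSpace ℝ (Fin d)) (x) :
    HasStrictFDerivAt (Fmap d I' E' σ p) (mL (sqM d I' E' σ (xExt d I' p x))) x := by
  rw [hasStrictFDerivAt_pi']
  intro j
  obtain ⟨⟨e, he⟩, rfl⟩ := σ.surjective j
  induction e using Sym2.ind with
  | _ u v =>
  have huv : u ≠ v := by simpa using hl _ he
  have h1 := (HasStrictFDerivAt.comp x (hasStrictFDerivAt_norm_sq _)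
    ((xExt_strict I' p x u).sub (xExt_strict I' p x v))).mul_const (1 / 2 : ℝ)
  simp only [Fmap, Equiv.symm_apply_apply, sqlen_mk]
  refine (h1.congr_fderiv ?_).congr_of_eventuallyEq (Filter.Eventually.of_forall fun y => ?_)
  · ext U : 1
    have := row_formula (xExt d I' p x) I' E' U u v huv he
    rw [← sqM_mulVec σ] at this
    simp only [ContinuousLinearMap.comp_apply, ContinuousLinearMap.proj_apply, mL_apply, this]
    simp [xLin, inner_sub_left, inner_sub_right]
    ring
  · simp; ring

noncomputable def mEquiv {J : Type*} [Fintype J] [DecidableEq J] (M : Matrix J J ℝ)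
    (h : M.det ≠ 0) : (J → ℝ) ≃L[ℝ] (J → ℝ) :=
  (LinearEquiv.ofIsUnitDet (f := Matrix.toLin' M) (v := Pi.basisFun ℝ J) (v' := Pi.basisFun ℝ J)
    (by simpa [LinearMap.toMatrix_eq_toMatrix'] using h)).toContinuousLinearEquiv

lemma mEquiv_coe {J : Type*} [Fintype J] [DecidableEq J] (M : Matrix J J ℝ)
    (h : M.det ≠ 0) : (mEquiv M h : (J → ℝ) →L[ℝ] (J → ℝ)) = mL M := by
  ext x; rfl

def xRes (d : ℕ) (I' : Finset V) (p : V → EuclideanSpace ℝ (Fin d)) :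
    {i // i ∈ I'} × Fin d → ℝ := fun j => p j.1 j.2

lemma xExt_res {d : ℕ} (I' : Finset V) (p q : V → EuclideanSpace ℝ (Fin d))
    (h : ∀ v, v ∉ I' → q v = p v) : xExt d I' p (xRes d I' q) = q := by
  funext v; ext k
  simp only [xExt, xRes]
  split_ifs with hv
  · simp
  · rw [h v hv]

lemma forward {d : ℕ} {I' : Finset V} {E' : Finset (Sym2 V)}
    (hl : ∀ e ∈ E', ¬ e.IsDiag)
    (σ : {e // e ∈ E'} ≃ {i // i ∈ I'} × Fin d) (p : V → EuclideanSpace ℝ (Fin d))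
    (hdet : (sqM d I' E' σ p).det ≠ 0) (e : Sym2 V) (he : e ∈ E')
    (U : {i // i ∈ I'} → EuclideanSpace ℝ (Fin d)) (hU : ∀ i, U i ≠ 0)
    (hk : (rMatrix d p I' (E'.erase e)).mulVec (fun ik => U ik.1 ik.2) = 0) :
    ∃ q : ℝ → V → EuclideanSpace ℝ (Fin d),
      ContinuousOn q (Set.Icc 0 1) ∧ q 0 = p ∧
      (∀ w, w ∉ I' → ∀ t ∈ Set.Icc (0:ℝ) 1, q t w = p w) ∧
      (∀ t ∈ Set.Icc (0:ℝ) 1, ∀ u v : V, s(u, v) ∈ E' → s(u, v) ≠ e →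
        ‖q t u - q t v‖ = ‖p u - p v‖) ∧
      (∀ i ∈ I', ∃ t ∈ Set.Icc (0:ℝ) 1, q t i ≠ q 0 i) := by
  classical
  set x0 := xRes d I' p with hx0
  have hx0p : xExt d I' p x0 = p := xExt_res I' p p fun _ _ => rfl
  set j := σ ⟨e, he⟩ with hj
  set F := Fmap d I' E' σ p with hF
  have hFd : HasStrictFDerivAt F (mEquiv _ hdet : _ →L[ℝ] _) x0 := by
    rw [mEquiv_coe]
    have := Fmap_strict hl σ p x0
    rwa [hx0p] at this
  set A := mEquiv _ hdet with hA
  set W := A.symm (Pi.single j 1) with hW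
  -- U is a multiple of W
  set U' : {i // i ∈ I'} × Fin d → ℝ := fun ik => U ik.1 ik.2 with hU'
  have hAU : A U' = (A U' j) • (Pi.single j 1 : _ → ℝ) := by
    ext j'
    by_cases hjj : j' = j
    · subst hjj; simp
    · obtain ⟨f, rfl⟩ := σ.surjective j'
      have hfe : f.1 ≠ e := by
        intro h; apply hjj; rw [hj]; congr 1; exact Subtype.ext h
      have h1 : A U' (σ f) = (rMatrix d p I' E').mulVec U' f := sqM_mulVec σ p U' f
      have h2 := congrFun hk ⟨f.1, Finset.mem_erase.2 ⟨hfe, f.2⟩⟩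
      have h3 : (rMatrix d p I' E').mulVec U' f = 0 := h2
      rw [h1, h3]; simp [hjj]
  have hUW : U' = (A U' j) • W := by
    rw [hW, ← map_smul, ← hAU, A.symm_apply_apply]
  have hWi : ∀ i : {i // i ∈ I'}, ∃ k, W (i, k) ≠ 0 := by
    intro i
    by_contra hcon
    push Not at hcon
    apply hU i
    ext k
    have := congrFun hUW (i, k)
    simp only [Pi.smul_apply, hcon k, smul_zero] at this
    simpa [hU'] using this
  set Φ := hFd.toOpenPartialHomeomorph F with hΦ
  set y0 := F x0 with hy0
  have hy0t : y0 ∈ Φ.target := hFd.image_mem_toOpenPartialHomeomorph_target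
  have hinv : Φ.symm y0 = x0 := Φ.left_inv hFd.mem_toOpenPartialHomeomorph_source
  have hg : HasStrictFDerivAt Φ.symm (A.symm : _ →L[ℝ] _) y0 := hFd.to_localInverse
  set ℓ : ℝ → ({i // i ∈ I'} × Fin d → ℝ) := fun s => y0 + s • Pi.single j 1 with hℓ
  have hℓ0 : ℓ 0 = y0 := by simp [hℓ]
  have hℓc : Continuous ℓ := by fun_prop
  have hℓd : HasDerivAt ℓ (Pi.single j 1) 0 := by
    have := ((hasDerivAt_id (0:ℝ)).smul_const (Pi.single j 1 : {i // i ∈ I'} × Fin d → ℝ)).const_add y0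
    simpa [hℓ] using this
  set γ : ℝ → ({i // i ∈ I'} × Fin d → ℝ) := fun s => Φ.symm (ℓ s) with hγ
  have hγ0 : γ 0 = x0 := by simp only [hγ, hℓ0, hinv]
  have hγd : HasDerivAt γ W 0 := by
    have hg' : HasFDerivAt Φ.symm (A.symm : _ →L[ℝ] _) (ℓ 0) := by
      rw [hℓ0]; exact hg.hasFDerivAt
    exact hg'.comp_hasDerivAt (0:ℝ) hℓd
  have hmove : ∀ᶠ s in nhdsWithin (0:ℝ) {0}ᶜ, ∀ i : {i // i ∈ I'}, ∃ k, γ s (i, k) ≠ x0 (i, k) := by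
    rw [Filter.eventually_all]
    intro i
    obtain ⟨k, hk⟩ := hWi i
    have h1 : HasDerivAt (fun s => γ s (i, k)) (W (i, k)) 0 := (hasDerivAt_pi.1 hγd) (i, k)
    have h2 := h1.eventually_ne (c := x0 (i, k)) hk
    exact h2.mono fun s hs => ⟨k, hs⟩
  have htgt : ∀ᶠ s in nhds (0:ℝ), ℓ s ∈ Φ.target :=
    hℓc.continuousAt.eventually_mem (by rw [hℓ0]; exact Φ.open_target.mem_nhds hy0t)
  obtain ⟨δ, hδ, hball⟩ := Metric.eventually_nhds_iff.1 htgt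
  have hmove' : ∀ᶠ s in nhdsWithin (0:ℝ) (Set.Ioi 0), ∀ i : {i // i ∈ I'}, ∃ k, γ s (i, k) ≠ x0 (i, k) :=
    hmove.filter_mono (nhdsWithin_mono _ fun s hs => ne_of_gt hs)
  obtain ⟨ε, hεm, hε0, hεδ⟩ := (hmove'.and (Ioo_mem_nhdsGT hδ)).exists
  have htT : ∀ t ∈ Set.Icc (0:ℝ) 1, ℓ (t * ε) ∈ Φ.target := by
    intro t ht
    apply hball
    rw [Real.dist_eq, sub_zero, abs_of_nonneg (mul_nonneg ht.1 hε0.le)]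
    nlinarith [ht.1, ht.2]
  refine ⟨fun t => xExt d I' p (γ (t * ε)), ?_, ?_, ?_, ?_, ?_⟩
  · refine (xExt_cont I' p).comp_continuousOn ?_
    refine Φ.continuousOn_symm.comp (s := Set.Icc (0:ℝ) 1) (f := fun t => ℓ (t * ε)) ?_ htT
    exact (hℓc.comp (by fun_prop)).continuousOn
  · simp only [zero_mul, hγ0, hx0p]
  · intro w hw t _
    simp [xExt, hw]
  · intro t ht u v huv hne
    have h1 : F (γ (t * ε)) = ℓ (t * ε) := Φ.right_inv (htT t ht)
    have h2 := congrFun h1 (σ ⟨s(u, v), huv⟩)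
    have hjne : σ ⟨s(u, v), huv⟩ ≠ j := by
      intro h; apply hne; rw [hj] at h; simpa using σ.injective h
    simp only [hℓ, hy0, Pi.add_apply, Pi.smul_apply, Pi.single_eq_of_ne hjne, smul_zero, add_zero,
      hF, Fmap, Equiv.symm_apply_apply, sqlen_mk, hx0p] at h2
    have h3 : ‖xExt d I' p (γ (t * ε)) u - xExt d I' p (γ (t * ε)) v‖ ^ 2 = ‖p u - p v‖ ^ 2 := by
      linarith
    exact (pow_left_inj₀ (norm_nonneg _) (norm_nonneg _) two_ne_zero).1 h3
  · intro i hi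
    refine ⟨1, by simp, ?_⟩
    obtain ⟨k, hk⟩ := hεm ⟨i, hi⟩
    intro h
    apply hk
    simp only [one_mul, zero_mul, hγ0, xExt, hi, dif_pos] at h
    have := congrArg (fun z : EuclideanSpace ℝ (Fin d) => z k) h
    simpa using this

lemma backward {d : ℕ} {I' : Finset V} {E' : Finset (Sym2 V)}
    (hl : ∀ e ∈ E', ¬ e.IsDiag)
    (σ : {e // e ∈ E'} ≃ {i // i ∈ I'} × Fin d)
    (hdet : ∃ p, (sqM d I' E' σ p).det ≠ 0) (e : Sym2 V) (he : e ∈ E')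
    (S : Set (V → EuclideanSpace ℝ (Fin d))) (hSo : IsOpen S) (hSd : Dense S)
    (i : {i // i ∈ I'})
    (hS : ∀ p ∈ S, ∃ q : ℝ → V → EuclideanSpace ℝ (Fin d),
      ContinuousOn q (Set.Icc 0 1) ∧ q 0 = p ∧
      (∀ w, w ∉ I' → ∀ t ∈ Set.Icc (0:ℝ) 1, q t w = p w) ∧
      (∀ t ∈ Set.Icc (0:ℝ) 1, ∀ u v : V, s(u, v) ∈ E' → s(u, v) ≠ e →
        ‖q t u - q t v‖ = ‖p u - p v‖) ∧
      (∀ i ∈ I', ∃ t ∈ Set.Icc (0:ℝ) 1, q t i ≠ q 0 i)) :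
    ∃ p k, (sqM d I' E' σ p).adjugate (i, k) (σ ⟨e, he⟩) ≠ 0 := by
  classical
  by_contra hcon
  push Not at hcon
  obtain ⟨hDo, hDd⟩ := dense_ne (fun p => (sqM d I' E' σ p).det)
    (fun p => det_analytic _ _ fun a b => sqM_entry_analytic σ a b p) hdet
  have : (V → EuclideanSpace ℝ (Fin d)) := 0
  obtain ⟨p0, hp0S, hp0⟩ := (hSd.inter_of_isOpen_left hDd hSo).nonempty
  set x0 := xRes d I' p0 with hx0
  have hx0p : xExt d I' p0 x0 = p0 := xExt_res I' p0 p0 fun _ _ => rfl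
  set j := σ ⟨e, he⟩ with hj
  set F := Fmap d I' E' σ p0 with hF
  have hFd : HasStrictFDerivAt F (mEquiv _ hp0 : _ →L[ℝ] _) x0 := by
    rw [mEquiv_coe]
    have := Fmap_strict hl σ p0 x0
    rwa [hx0p] at this
  set H : Fin d → ({i // i ∈ I'} × Fin d → ℝ) → ({i // i ∈ I'} × Fin d → ℝ) :=
    fun k x => Function.update (F x) j (x (i, k)) with hH
  have hHd : ∀ k x, HasFDerivAt (H k)
      (mL ((sqM d I' E' σ (xExt d I' p0 x)).updateRow j (Pi.single (i, k) 1))) x := by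
    intro k x
    rw [hasFDerivAt_pi']
    intro j'
    by_cases hjj : j' = j
    · subst hjj
      have h1 : HasFDerivAt (fun x : {i // i ∈ I'} × Fin d → ℝ => x (i, k))
        (ContinuousLinearMap.proj (R := ℝ) (φ := fun _ => ℝ) (i, k)) x :=
        (ContinuousLinearMap.proj (R := ℝ) (φ := fun _ => ℝ) (i, k)).hasFDerivAt
      simp only [hH, Function.update_self]
      refine h1.congr_fderiv ?_
      ext U : 1
      simp [mL_apply, Matrix.mulVec, Matrix.updateRow_self]
    · simp only [hH, Function.update_of_ne hjj]
      have h1 := hasFDerivAt_pi'.1 (Fmap_strict hl σ p0 x).hasFDerivAt j'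
      refine h1.congr_fderiv ?_
      ext U : 1
      simp [mL_apply, Matrix.mulVec, Matrix.updateRow_ne hjj]
  have hnull : ∀ k, MeasureTheory.volume (Set.range (H k)) = 0 := by
    intro k
    rw [← Set.image_univ]
    refine MeasureTheory.addHaar_image_eq_zero_of_det_fderivWithin_eq_zero _
      (fun x _ => (hHd k x).hasFDerivWithinAt) fun x _ => ?_
    have := hcon (xExt d I' p0 x) k
    rw [Matrix.adjugate_apply] at this
    rw [← this]
    simp [mL, ContinuousLinearMap.det]
  set N : Set ({i // i ∈ I'} × Fin d → ℝ) :=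
    ⋃ (k : Fin d) (r : ℚ), (fun y => y + (r : ℝ) • Pi.single j (1:ℝ)) ⁻¹' (Set.range (H k)) with hN
  have hN0 : MeasureTheory.volume N = 0 := by
    refine MeasureTheory.measure_iUnion_null fun k => MeasureTheory.measure_iUnion_null fun r => ?_
    rw [MeasureTheory.measure_preimage_add_right]
    exact hnull k
  set B : Set ({i // i ∈ I'} × Fin d → ℝ) := {x | xExt d I' p0 x ∈ S} with hB
  have hBn : B ∈ nhds x0 := by
    refine (xExt_cont I' p0).continuousAt.preimage_mem_nhds ?_
    rw [hx0p]; exact hSo.mem_nhds hp0S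
  have hFB : F '' B ∈ nhds (F x0) := by
    rw [← hFd.map_nhds_eq_of_equiv]
    exact Filter.image_mem_map hBn
  have hsub : F '' B ⊆ N := by
    rintro _ ⟨x, hx, rfl⟩
    obtain ⟨q, hqc, hq0, hqp, hql, hqm⟩ := hS _ hx
    obtain ⟨t, ht, hti⟩ := hqm i.1 i.2
    have hk : ∃ k, q t i k ≠ q 0 i k := by
      by_contra h
      push Not at h
      exact hti (PiLp.ext h)
    obtain ⟨k, hk⟩ := hk
    have hc : ContinuousOn (fun s => q s i k) (Set.Icc 0 1) := by
      have h1 : Continuous (fun z : V → EuclideanSpace ℝ (Fin d) => z i k) := by fun_prop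
      exact h1.comp_continuousOn hqc
    have hpre : IsPreconnected ((fun s => q s i k) '' (Set.Icc 0 1)) :=
      isPreconnected_Icc.image _ hc
    have hiv : ∃ r : ℚ, F x j + r ∈ (fun s => q s i k) '' (Set.Icc 0 1) := by
      have h0m : (0:ℝ) ∈ Set.Icc (0:ℝ) 1 := by simp
      rcases lt_or_gt_of_ne hk with h | h
      · obtain ⟨r, hr1, hr2⟩ := exists_rat_btwn (sub_lt_sub_right h (F x j))
        refine ⟨r, hpre.Icc_subset ⟨t, ht, rfl⟩ ⟨0, h0m, rfl⟩ ⟨?_, ?_⟩⟩ <;> dsimp only <;> linarith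
      · obtain ⟨r, hr1, hr2⟩ := exists_rat_btwn (sub_lt_sub_right h (F x j))
        refine ⟨r, hpre.Icc_subset ⟨0, h0m, rfl⟩ ⟨t, ht, rfl⟩ ⟨?_, ?_⟩⟩ <;> dsimp only <;> linarith
    obtain ⟨r, s, hs, hsr⟩ := hiv
    simp only [hN, Set.mem_iUnion]
    refine ⟨k, r, xRes d I' (q s), ?_⟩
    have hext : xExt d I' p0 (xRes d I' (q s)) = q s := by
      refine xExt_res I' p0 _ fun v hv => ?_
      rw [hqp v hv s hs]; simp [xExt, hv]
    ext j'
    by_cases hjj : j' = j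
    · rw [hjj]
      simp only [hH, Function.update_self, Pi.add_apply, Pi.smul_apply, Pi.single_eq_same, smul_eq_mul, mul_one]
      exact hsr
    · simp only [hH, Function.update_of_ne hjj, Pi.add_apply, Pi.smul_apply, Pi.single_eq_of_ne hjj,
        smul_zero, add_zero]
      obtain ⟨⟨f, hf⟩, rfl⟩ := σ.surjective j'
      induction f using Sym2.ind with
      | _ u v =>
      have hne : s(u, v) ≠ e := by
        intro h; apply hjj; rw [hj]; congr 1; exact Subtype.ext h
      simp only [hF, Fmap, Equiv.symm_apply_apply, sqlen_mk, hext]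
      rw [hql s hs u v hf hne]
  have hpos := MeasureTheory.Measure.measure_pos_of_mem_nhds MeasureTheory.volume hFB
  exact hpos.ne' (MeasureTheory.measure_mono_null hsub hN0)

/-- A pinned `d`-isostatic graph is strongly `d`-Assur if and only if
there is a dense open set of configurations `p` such that, for every edge `e`, there is
a continuous path of configurations starting at `p`, fixing every pinned vertex,
preserving the lengths of all edges other than `e`, and nonconstant at every inner
vertex (a finite motion that is nonzero at all inner vertices). -/
theorem stmt14 {V : Type} [Fintype V] [DecidableEq V] (d : ℕ) (hd : 1 ≤ d)
    (G : PinnedGraph V) (hiso : ∃ p, IsostaticAt d p G.inner G.edges) :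
    IsStronglyAssur d G ↔
      ∃ S : Set (V → EuclideanSpace ℝ (Fin d)), IsOpen S ∧ Dense S ∧
        ∀ p ∈ S, ∀ e ∈ G.edges,
          ∃ q : ℝ → V → EuclideanSpace ℝ (Fin d),
            ContinuousOn q (Set.Icc 0 1) ∧ q 0 = p ∧
            (∀ w ∈ G.pinned, ∀ t ∈ Set.Icc (0:ℝ) 1, q t w = p w) ∧
            (∀ t ∈ Set.Icc (0:ℝ) 1, ∀ u v : V, s(u, v) ∈ G.edges → s(u, v) ≠ e →
              ‖q t u - q t v‖ = ‖p u - p v‖) ∧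
            (∀ i ∈ G.inner, ∃ t ∈ Set.Icc (0:ℝ) 1, q t i ≠ q 0 i) := by
  have hnotmem : ∀ w, w ∉ G.inner ↔ w ∈ G.pinned := by
    intro w
    have h1 : w ∈ G.inner ∪ G.pinned := by rw [G.cover]; simp
    have h2 : w ∈ G.inner → w ∉ G.pinned := fun h => Finset.disjoint_left.1 G.disj h
    rw [Finset.mem_union] at h1
    tauto
  obtain ⟨pI, hcard, hpI⟩ := hiso
  obtain ⟨σ⟩ := exists_sigma hcard
  obtain ⟨hKo, hKd⟩ := dense_kt ⟨pI, hcard, hpI⟩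
  constructor
  · rintro ⟨_, S, hSo, hSd, hS⟩
    refine ⟨S ∩ {p | KernelTrivial (rMatrix d p G.inner G.edges)}, hSo.inter hKo,
      hSd.inter_of_isOpen_left hKd hSo, ?_⟩
    rintro p ⟨hpS, hpK⟩ e he
    obtain ⟨U, hU, hUk⟩ := hS p hpS e he
    obtain ⟨q, h1, h2, h3, h4, h5⟩ :=
      forward G.loopless σ p ((kt_iff σ p).1 hpK) e he U hU hUk
    exact ⟨q, h1, h2, fun w hw => h3 w ((hnotmem w).2 hw), h4, h5⟩
  · rintro ⟨S, hSo, hSd, hS⟩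
    have hadj : ∀ (e : {e // e ∈ G.edges}) (i : {i // i ∈ G.inner}), ∃ p k,
        (sqM d G.inner G.edges σ p).adjugate (i, k) (σ e) ≠ 0 := by
      intro e i
      refine backward G.loopless σ ⟨pI, (kt_iff σ pI).1 hpI⟩ e.1 e.2 S hSo hSd i ?_
      intro p hp
      obtain ⟨q, h1, h2, h3, h4, h5⟩ := hS p hp e.1 e.2
      exact ⟨q, h1, h2, fun w hw => h3 w ((hnotmem w).1 hw), h4, h5⟩
    choose pp kk hpp using hadj
    set T : {e // e ∈ G.edges} × {i // i ∈ G.inner} → Set (V → EuclideanSpace ℝ (Fin d)) :=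
      fun ei => {p | (sqM d G.inner G.edges σ p).adjugate (ei.2, kk ei.1 ei.2) (σ ei.1) ≠ 0} with hT
    have hTod : ∀ ei, IsOpen (T ei) ∧ Dense (T ei) := fun ei =>
      dense_ne _ (fun p => adj_analytic σ _ _ p) ⟨_, hpp ei.1 ei.2⟩
    set D := ⋂ ei, T ei with hD
    have hDo : IsOpen D := isOpen_iInter_of_finite fun ei => (hTod ei).1
    have hDd : Dense D := dense_iInter_of_isOpen (fun ei => (hTod ei).1) fun ei => (hTod ei).2
    have hker : ∀ p ∈ D, ∀ e ∈ G.edges, ∃ U : {i // i ∈ G.inner} → EuclideanSpace ℝ (Fin d),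
        (∀ i, U i ≠ 0) ∧
        (rMatrix d p G.inner (G.edges.erase e)).mulVec (fun ik => U ik.1 ik.2) = 0 := by
      intro p hp e he
      set M := sqM d G.inner G.edges σ p with hM
      refine ⟨fun i => WithLp.toLp 2 fun k => M.adjugate (i, k) (σ ⟨e, he⟩), ?_, ?_⟩
      · intro i hi
        have h1 := Set.mem_iInter.1 hp (⟨e, he⟩, i)
        apply h1
        have := congrArg (fun z : EuclideanSpace ℝ (Fin d) => z (kk ⟨e, he⟩ i)) hi
        simpa using this
      · ext f
        obtain ⟨f, hf⟩ := f
        obtain ⟨hfe, hfE⟩ := Finset.mem_erase.1 hf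
        have h1 : (rMatrix d p G.inner G.edges).mulVec (fun ik => M.adjugate ik (σ ⟨e, he⟩)) ⟨f, hfE⟩ = 0 := by
          rw [← sqM_mulVec σ]
          have h2 := congrFun (congrFun (Matrix.mul_adjugate M) (σ ⟨f, hfE⟩)) (σ ⟨e, he⟩)
          have h3 : σ ⟨f, hfE⟩ ≠ σ ⟨e, he⟩ := by
            intro h; exact hfe (by simpa using σ.injective h)
          rw [Matrix.smul_apply, Matrix.one_apply_ne h3, smul_zero] at h2
          exact h2
        exact h1
    refine ⟨⟨⟨pI, hcard, hpI⟩, ?_⟩, D, hDo, hDd, hker⟩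
    intro I' P' E' hsub hne hEne hex
    obtain ⟨hLo, hLd⟩ := dense_kt hex
    have : (V → EuclideanSpace ℝ (Fin d)) := 0
    obtain ⟨p, hpD, hpK⟩ := (hDd.inter_of_isOpen_left hLd hDo).nonempty
    obtain ⟨e, heE, heE'⟩ := Finset.exists_of_ssubset (hsub.edges_sub.ssubset_of_ne hEne)
    obtain ⟨U, hU, hUk⟩ := hker p hpD e heE
    obtain ⟨i, hi⟩ := hne
    set U1 : {i // i ∈ I'} × Fin d → ℝ := fun ik => U ⟨ik.1, hsub.inner_sub ik.1.2⟩ ik.2 with hU1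
    have hz : U1 = 0 := by
      apply hpK
      ext f
      obtain ⟨f, hf⟩ := f
      have hfe : f ≠ e := fun h => heE' (h ▸ hf)
      have hfm : f ∈ G.edges.erase e := Finset.mem_erase.2 ⟨hfe, hsub.edges_sub hf⟩
      have hend := hsub.endpoints f hf
      have hlo := G.loopless f (hsub.edges_sub hf)
      induction f using Sym2.ind with
      | _ u v =>
      have huv : u ≠ v := by simpa using hlo
      have h1 := congrFun hUk ⟨s(u, v), hfm⟩
      rw [row_formula _ _ _ _ u v huv] at h1
      rw [row_formula _ _ _ _ u v huv]
      have hx : ∀ w ∈ s(u, v), xExt d I' 0 U1 w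
          = xExt d G.inner 0 (fun ik => U ik.1 ik.2) w := by
        intro w hw
        have h2 := hend w hw
        by_cases hwI : w ∈ I'
        · simp [xExt, hwI, hsub.inner_sub hwI, hU1]
        · have h3 : w ∈ G.pinned := hsub.pinned_sub (by
            rcases Finset.mem_union.1 h2 with h | h
            · exact absurd h hwI
            · exact h)
          simp [xExt, hwI, (hnotmem w).2 h3]
      rw [hx u (by simp), hx v (by simp)]
      exact h1
    apply hU ⟨i, hsub.inner_sub hi⟩
    ext k
    exact congrFun hz (⟨i, hi⟩, k)
end

section
/- Let d ≥ 1 and let G̃ = (I,P;E) be a pinned graph with I nonempty and |E| = d|I|. For an inner vertex v, let G̃ − v denote the pinned graph (I ∖ {v}, P; E_v), where E_v is the set of edges of E not incident to v. Suppose there is a dense subset S of the configuration space (ℝ^d)^{I ∪ P} such that for every p ∈ S: R(G̃,p) is invertible, and for every inner vertex v with I ∖ {v} nonempty there exists U ∈ (ℝ^d)^{I∖{v}} with U(i) ≠ 0 for every i ∈ I ∖ {v} and R(G̃ − v, p)·U = 0. Then G̃ is a d-Assur graph. -/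
open Matrix

variable {V : Type} [Fintype V] [DecidableEq V]

theorem kt_iff_aux {m n : Type} [Fintype m] [Fintype n] [DecidableEq n] (M : Matrix m n ℝ) :
    KernelTrivial M ↔ (Mᵀ * M).det ≠ 0 := by
  rw [Ne, ← Matrix.exists_mulVec_eq_zero_iff]
  have key : ∀ U : n → ℝ, (Mᵀ * M) *ᵥ U = 0 ↔ M *ᵥ U = 0 := by
    intro U
    have := Matrix.conjTranspose_mul_self_mulVec_eq_zero M U
    rwa [Matrix.conjTranspose_eq_transpose_of_trivial] at this
  simp only [key]
  unfold KernelTrivial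
  constructor
  · rintro h ⟨U, h0, h1⟩
    exact h0 (h U h1)
  · intro h U hU
    by_contra h0
    exact h ⟨U, h0, hU⟩

theorem kt_open_aux {V : Type} [Fintype V] [DecidableEq V] (d : ℕ)
    (I' : Finset V) (E' : Finset (Sym2 V)) :
    IsOpen {p : V → EuclideanSpace ℝ (Fin d) | KernelTrivial (rMatrix d p I' E')} := by
  simp only [kt_iff_aux]
  have hc : Continuous fun p : V → EuclideanSpace ℝ (Fin d) => rMatrix d p I' E' := by
    refine continuous_matrix fun e ik => ?_
    unfold rMatrix
    simp only [Matrix.of_apply]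
    split_ifs with h
    · simp only [PiLp.sub_apply]
      fun_prop
    · exact continuous_const
  exact isOpen_ne_fun ((hc.matrix_transpose.matrix_mul hc).matrix_det) continuous_const

/-- If on a dense set of configurations the pinned rigidity matrix of a
pinned graph with `|E| = d|I|` is invertible and, for every inner vertex `v` (leaving
some inner vertex), the graph `G - v` has a kernel vector nonzero at every remaining
inner vertex, then the graph is `d`-Assur. -/
theorem stmt15 {V : Type} [Fintype V] [DecidableEq V] (d : ℕ) (hd : 1 ≤ d)
    (G : PinnedGraph V) (hI : G.inner.Nonempty)
    (hcard : G.edges.card = d * G.inner.card)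
    (S : Set (V → EuclideanSpace ℝ (Fin d))) (hS : Dense S)
    (h : ∀ p ∈ S, KernelTrivial (rMatrix d p G.inner G.edges) ∧
      ∀ v ∈ G.inner, (G.inner.erase v).Nonempty →
        ∃ U : {i // i ∈ G.inner.erase v} → EuclideanSpace ℝ (Fin d),
          (∀ i, U i ≠ 0) ∧
          (rMatrix d p (G.inner.erase v) (G.edges.filter fun e => ¬ v ∈ e)).mulVec
            (fun ik => U ik.1 ik.2) = 0) :
    IsAssur d G := by
  obtain ⟨p1, hp1⟩ := hS.nonempty
  refine ⟨⟨p1, hcard, (h p1 hp1).1⟩, ?_⟩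
  rintro I' P' E' hsub hne hE ⟨p0, hc0, hk0⟩
  obtain ⟨p, hp, hpS⟩ := hS.inter_open_nonempty _ (kt_open_aux d I' E') ⟨p0, hk0⟩
  have hk : KernelTrivial (rMatrix d p I' E') := hp
  have hlt : E'.card < G.edges.card := Finset.card_lt_card (hsub.edges_sub.ssubset_of_ne hE)
  rw [hc0, hcard] at hlt
  have hlt2 : I'.card < G.inner.card := lt_of_mul_lt_mul_left hlt (Nat.zero_le d)
  obtain ⟨v, hv, hvI⟩ := Finset.exists_mem_notMem_of_card_lt_card hlt2
  have hpin : ∀ e ∈ E', ∀ w ∈ e, w ∈ G.inner → w ∈ I' := by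
    intro e he w hw hwi
    rcases Finset.mem_union.1 (hsub.endpoints e he w hw) with h1 | h1
    · exact h1
    · exact absurd (hsub.pinned_sub h1) (Finset.disjoint_left.1 G.disj hwi)
  have hIs : ∀ i ∈ I', i ∈ G.inner.erase v := fun i hi =>
    Finset.mem_erase.2 ⟨fun hh => hvI (hh ▸ hi), hsub.inner_sub hi⟩
  obtain ⟨i0, hi0⟩ := hne
  obtain ⟨U, hU0, hU⟩ := (h p hpS).2 v hv ⟨i0, hIs i0 hi0⟩
  have hz := hk (fun ik => U ⟨ik.1, hIs _ ik.1.2⟩ ik.2) ?_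
  · apply hU0 ⟨i0, hIs i0 hi0⟩
    ext k
    exact congrFun hz (⟨i0, hi0⟩, k)
  · funext e
    have heG : (e : Sym2 V) ∈ G.edges.filter fun e => ¬ v ∈ e :=
      Finset.mem_filter.2 ⟨hsub.edges_sub e.2, fun hve => hvI (hpin _ e.2 v hve hv)⟩
    have h1 := congrFun hU ⟨e, heG⟩
    refine Eq.trans ?_ h1
    simp only [Matrix.mulVec, dotProduct]
    let f : {i // i ∈ I'} × Fin d → {i // i ∈ G.inner.erase v} × Fin d :=
      fun ik => (⟨ik.1, hIs _ ik.1.2⟩, ik.2)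
    refine Fintype.sum_of_injective f ?_ _ _ ?_ ?_
    · rintro ⟨⟨a, ha⟩, k⟩ ⟨⟨b, hb⟩, l⟩ hab
      simpa [f] using hab
    · rintro ⟨⟨a, ha⟩, k⟩ hn
      have : a ∉ (e : Sym2 V) := by
        intro hae
        exact hn ⟨(⟨a, hpin _ e.2 a hae (Finset.mem_of_mem_erase ha)⟩, k), rfl⟩
      simp [rMatrix, this]
    · intro ik
      rfl
end
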